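/- arXiv:gr-qc/0308091 — 9 statements merged into one kernel-verified Lean document; each statement's English description precedes it below -/
import Mathlib

section
/- Let n ≥ 2 and let L : ℝⁿ → ℝⁿ be a bijective linear map such that L u ∈ Θ⁺ for every u ∈ Θ⁺. Then there exist a vector u ∈ Θ⁺ and a real number β > 0 such that L u = β u. (Every linear automorphism of Minkowski space preserving the future causal cone has a future-directed causal eigenvector with positive eigenvalue.) -/
open Finset

/-- The Minkowski (Lorentzian) bilinear form on `Fin n → ℝ`:
`η(u,v) = u 0 * v 0 - ∑_{i ≠ 0} u i * v i`. -/
def eta {n : ℕ} [NeZero n] (u v : Fin n → ℝ) : ℝ :=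
  u 0 * v 0 - ∑ i ∈ Finset.univ.filter (fun i => i ≠ 0), u i * v i

/-- A future-directed causal vector: nonzero, `η(u,u) ≥ 0`, `u 0 > 0`.  (The set Θ⁺.) -/
def FutureCausal {n : ℕ} [NeZero n] (u : Fin n → ℝ) : Prop :=
  u ≠ 0 ∧ 0 ≤ eta u u ∧ 0 < u 0

/-- A future-directed null vector: nonzero, `η(u,u) = 0`, `u 0 > 0`.  (The set ∂Θ⁺.) -/
def FutureNull {n : ℕ} [NeZero n] (u : Fin n → ℝ) : Prop :=
  u ≠ 0 ∧ eta u u = 0 ∧ 0 < u 0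

/-- A null vector: nonzero with `η(u,u) = 0`. -/
def IsNull {n : ℕ} [NeZero n] (u : Fin n → ℝ) : Prop :=
  u ≠ 0 ∧ eta u u = 0

theorem eta_cont {n : ℕ} [NeZero n] : Continuous (fun u : Fin n → ℝ => eta u u) := by
  unfold eta
  fun_prop

theorem eta_smul_self {n : ℕ} [NeZero n] (c : ℝ) (u : Fin n → ℝ) :
    eta (c • u) (c • u) = c ^ 2 * eta u u := by
  simp only [eta, Pi.smul_apply, smul_eq_mul, mul_sub, Finset.mul_sum]
  congr 1
  · ring
  · exact Finset.sum_congr rfl (fun i _ => by ring)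

theorem eta_add_single {n : ℕ} [NeZero n] (c : ℝ) (u : Fin n → ℝ) :
    eta (u + c • Pi.single 0 1) (u + c • Pi.single 0 1) = eta u u + 2 * c * u 0 + c ^ 2 := by
  have h : ∑ i ∈ Finset.univ.filter (fun i : Fin n => i ≠ 0),
      (u + c • (Pi.single 0 1 : Fin n → ℝ)) i * (u + c • (Pi.single 0 1 : Fin n → ℝ)) i
      = ∑ i ∈ Finset.univ.filter (fun i : Fin n => i ≠ 0), u i * u i := by
    refine Finset.sum_congr rfl (fun i hi => ?_)
    have hi0 : i ≠ 0 := (Finset.mem_filter.mp hi).2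
    simp [Pi.single_eq_of_ne hi0]
  unfold eta
  rw [h]
  simp
  ring

theorem coord_sq_le {n : ℕ} [NeZero n] (u : Fin n → ℝ) (h : 0 ≤ eta u u) (i : Fin n) :
    u i ^ 2 ≤ u 0 ^ 2 := by
  by_cases hi : i = 0
  · rw [hi]
  · have := Finset.single_le_sum (f := fun i => u i * u i)
      (s := Finset.univ.filter (fun i : Fin n => i ≠ 0))
      (fun j _ => mul_self_nonneg (u j)) (Finset.mem_filter.mpr ⟨Finset.mem_univ i, hi⟩)
    unfold eta at h
    nlinarith

theorem future_of_ne {n : ℕ} [NeZero n] (u : Fin n → ℝ) (h0 : 0 ≤ u 0) (h : 0 ≤ eta u u)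
    (hne : u ≠ 0) : FutureCausal u := by
  refine ⟨hne, h, lt_of_le_of_ne h0 (fun h00 => hne ?_)⟩
  funext i
  have := coord_sq_le u h i
  rw [← h00] at this
  have : u i ^ 2 = 0 := le_antisymm (by simpa using this) (sq_nonneg _)
  simpa using this

theorem future_of_pos {n : ℕ} [NeZero n] (u : Fin n → ℝ) (h0 : 0 < u 0) (h : 0 ≤ eta u u) :
    FutureCausal u :=
  ⟨fun h' => by simp [h'] at h0, h, h0⟩

theorem base_abs {n : ℕ} [NeZero n] (x : Fin n → ℝ) (h0 : x 0 = 1) (h : 0 ≤ eta x x) (i : Fin n) :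
    |x i| ≤ 1 := by
  have := coord_sq_le x h i
  rw [h0] at this
  simpa using this

theorem base_compact {n : ℕ} [NeZero n] :
    IsCompact {x : Fin n → ℝ | x 0 = 1 ∧ 0 ≤ eta x x} := by
  refine (isCompact_Icc (a := (fun _ => -1 : Fin n → ℝ)) (b := fun _ => 1)).of_isClosed_subset ?_ ?_
  · exact (isClosed_eq (by fun_prop) continuous_const).inter
      (isClosed_le continuous_const eta_cont)
  · rintro x ⟨h0, h⟩
    exact ⟨fun i => (abs_le.mp (base_abs x h0 h i)).1, fun i => (abs_le.mp (base_abs x h0 h i)).2⟩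

theorem eta_single {n : ℕ} [NeZero n] :
    eta (Pi.single 0 1 : Fin n → ℝ) (Pi.single 0 1) = 1 := by
  have := eta_add_single (n := n) 1 0
  simpa [eta] using this

/-- Strictly positive maps have an eigenvector in the cone. -/
theorem strict_case {n : ℕ} [NeZero n]
    (M : (Fin n → ℝ) →ₗ[ℝ] (Fin n → ℝ))
    (hM : ∀ u, FutureCausal u → 0 < (M u) 0 ∧ 0 < eta (M u) (M u)) :
    ∃ x : Fin n → ℝ, (x 0 = 1 ∧ 0 ≤ eta x x) ∧ ∃ r : ℝ, M x = r • x := by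
  have hMc : Continuous M := M.continuous_of_finiteDimensional
  have heB : (Pi.single 0 1 : Fin n → ℝ) ∈ {x : Fin n → ℝ | x 0 = 1 ∧ 0 ≤ eta x x} :=
    ⟨by simp, by rw [eta_single]; norm_num⟩
  obtain ⟨m, -, hm⟩ := base_compact.exists_isMaxOn ⟨_, heB⟩
    (f := fun x : Fin n → ℝ => (M x) 0) (by fun_prop)
  set C := (M m) 0 with hC
  let S : Set ((Fin n → ℝ) × ℝ) := {p | (p.1 0 = 1 ∧ 0 ≤ eta p.1 p.1) ∧ 0 ≤ p.2 ∧
    0 ≤ (M p.1 - p.2 • p.1) 0 ∧ 0 ≤ eta (M p.1 - p.2 • p.1) (M p.1 - p.2 • p.1)}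
  have hgc : Continuous (fun p : (Fin n → ℝ) × ℝ => M p.1 - p.2 • p.1) := by fun_prop
  have hS : IsCompact S := by
    refine (base_compact.prod (isCompact_Icc (a := 0) (b := C))).of_isClosed_subset ?_ ?_
    · refine IsClosed.inter (IsClosed.inter (isClosed_eq (by fun_prop) continuous_const)
        (isClosed_le continuous_const (eta_cont.comp continuous_fst)))
        (IsClosed.inter (isClosed_le continuous_const continuous_snd)
        (IsClosed.inter (isClosed_le continuous_const ((continuous_apply 0).comp hgc))
        (isClosed_le continuous_const (eta_cont.comp hgc))))
    · rintro ⟨x, r⟩ ⟨hx, hr, h1, -⟩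
      refine ⟨hx, hr, ?_⟩
      have := hm hx
      have hx0 := hx.1
      simp only [Pi.sub_apply, Pi.smul_apply, smul_eq_mul] at h1 hx0
      rw [hx0] at h1
      simp only [Set.mem_ofPred_eq] at this
      change r ≤ C
      linarith
  have hne : S.Nonempty := by
    have := hM _ (future_of_pos _ (by rw [heB.1]; norm_num) heB.2)
    exact ⟨(Pi.single 0 1, 0), heB, le_rfl, by simpa using this.1.le, by simpa using this.2.le⟩
  obtain ⟨⟨x, r⟩, ⟨hx, hr, h1, h2⟩, hmax⟩ := hS.exists_isMaxOn hne continuous_snd.continuousOn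
  refine ⟨x, hx, r, ?_⟩
  by_contra hcon
  simp only at hx hr h1 h2
  obtain ⟨hz0, hz⟩ := hM _ (future_of_ne _ h1 h2 (sub_ne_zero.mpr hcon))
  obtain ⟨hy0, hy⟩ := hM x (future_of_pos _ (by rw [hx.1]; norm_num) hx.2)
  set y := M x with hydef
  have hcont : Continuous (fun d : ℝ => M (y - r • x) - d • y) := by fun_prop
  have e1 : ∀ᶠ d in nhds (0:ℝ), 0 < (M (y - r • x) - d • y) 0 :=
    ((continuous_apply 0).comp hcont).continuousAt.eventually (lt_mem_nhds (by simpa using hz0))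
  have e2 : ∀ᶠ d in nhds (0:ℝ), 0 < eta (M (y - r • x) - d • y) (M (y - r • x) - d • y) :=
    (eta_cont.comp hcont).continuousAt.eventually (lt_mem_nhds (by simpa using hz))
  obtain ⟨d, ⟨hd1, hd2⟩, hd⟩ :=
    (((e1.and e2).filter_mono nhdsWithin_le_nhds).and
      (self_mem_nhdsWithin : Set.Ioi (0:ℝ) ∈ nhdsWithin 0 (Set.Ioi 0))).exists
  have hd : 0 < d := hd
  have key : M ((y 0)⁻¹ • y) - (r + d) • ((y 0)⁻¹ • y) = (y 0)⁻¹ • (M (y - r • x) - d • y) := by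
    rw [map_smul, map_sub, map_smul, ← hydef]
    module
  have hmem : ((y 0)⁻¹ • y, r + d) ∈ S := by
    refine ⟨⟨?_, ?_⟩, by simp only; linarith, ?_, ?_⟩
    · simp [hy0.ne']
    · simp only; rw [eta_smul_self]; positivity
    · simp only; rw [key, Pi.smul_apply, smul_eq_mul]; positivity
    · simp only; rw [key, eta_smul_self]; positivity
  have := hmax hmem
  simp only [Set.mem_ofPred_eq] at this
  linarith

/-- Every linear automorphism of Minkowski space preserving the future causal cone
has a future-directed causal eigenvector with positive eigenvalue. -/
theorem stmt_0 {n : ℕ} [NeZero n] (hn : 2 ≤ n)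
    (L : (Fin n → ℝ) →ₗ[ℝ] (Fin n → ℝ)) (hL : Function.Bijective L)
    (hcaus : ∀ u, FutureCausal u → FutureCausal (L u)) :
    ∃ u, FutureCausal u ∧ ∃ β : ℝ, 0 < β ∧ L u = β • u := by
  have hLc : Continuous L := L.continuous_of_finiteDimensional
  have heB : (Pi.single 0 1 : Fin n → ℝ) ∈ {x : Fin n → ℝ | x 0 = 1 ∧ 0 ≤ eta x x} :=
    ⟨by simp, by rw [eta_single]; norm_num⟩
  obtain ⟨x, hx, hmin⟩ := base_compact.exists_isMinOn ⟨_, heB⟩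
    (f := fun x : Fin n → ℝ => ‖L x - (L x) 0 • x‖) (by fun_prop)
  have hxF := future_of_pos x (by rw [hx.1]; norm_num) hx.2
  refine ⟨x, hxF, (L x) 0, (hcaus x hxF).2.2, ?_⟩
  by_contra hcon
  have hpos : 0 < ‖L x - (L x) 0 • x‖ := norm_pos_iff.mpr (sub_ne_zero.mpr hcon)
  set δ := ‖L x - (L x) 0 • x‖ with hδ
  have hε : 0 < δ / 4 := by positivity
  set ε := δ / 4 with hεd
  let M : (Fin n → ℝ) →ₗ[ℝ] (Fin n → ℝ) :=
    L + ε • (LinearMap.proj (R := ℝ) (φ := fun _ : Fin n => ℝ) 0).smulRight (Pi.single 0 1)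
  have hMa : ∀ u, M u = L u + (ε * u 0) • Pi.single 0 1 := by
    intro u
    simp only [M, LinearMap.add_apply, LinearMap.smul_apply, LinearMap.smulRight_apply,
      LinearMap.proj_apply, smul_smul]
  obtain ⟨y, hy, r, hr⟩ := strict_case M (by
    intro u hu
    obtain ⟨-, h1, h2⟩ := hcaus u hu
    have h3 := hu.2.2
    rw [hMa, eta_add_single]
    constructor
    · simp only [Pi.add_apply, Pi.smul_apply, Pi.single_eq_same, smul_eq_mul]
      positivity
    · positivity)
  rw [hMa, hy.1, mul_one] at hr
  have hr0 := congrFun hr 0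
  simp only [Pi.add_apply, Pi.smul_apply, Pi.single_eq_same, smul_eq_mul, hy.1, mul_one] at hr0
  have h1 : L y - (L y) 0 • y = ε • (y - Pi.single 0 1) := by
    have : L y = r • y - ε • Pi.single 0 1 := eq_sub_of_add_eq hr
    have h0 : (L y) 0 = r - ε := by linarith
    rw [h0, this]
    module
  have h2 : ‖y - (Pi.single 0 1 : Fin n → ℝ)‖ ≤ 2 := by
    refine (norm_sub_le _ _).trans ?_
    have a : ∀ v : Fin n → ℝ, (v 0 = 1 ∧ 0 ≤ eta v v) → ‖v‖ ≤ 1 := fun v hv =>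
      (pi_norm_le_iff_of_nonneg zero_le_one).mpr (fun i => base_abs v hv.1 hv.2 i)
    have := a _ hy
    have := a _ heB
    linarith
  have h3 : δ ≤ ‖L y - (L y) 0 • y‖ := hmin hy
  rw [h1, norm_smul, Real.norm_of_nonneg hε.le] at h3
  nlinarith
end

section
/- Let n ≥ 3 and let L : ℝⁿ → ℝⁿ be a bijective linear map such that η(L k, L k) ≥ 0 for every null vector k. Then either L u ∈ Θ⁺ for every u ∈ Θ⁺, or −L u ∈ Θ⁺ for every u ∈ Θ⁺ (i.e. L is either a causal or an anticausal map of the cone). -/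
open Finset

section helpers
variable {n : ℕ} [NeZero n]

lemma eta_add_smul (w s : Fin n → ℝ) (t : ℝ) :
    eta (w + t • s) (w + t • s) = eta w w + 2 * t * eta w s + t ^ 2 * eta s s := by
  have h : ∑ i ∈ Finset.univ.filter (fun i : Fin n => i ≠ 0), (w + t • s) i * (w + t • s) i =
      ∑ i ∈ Finset.univ.filter (fun i : Fin n => i ≠ 0), w i * w i
      + 2 * t * ∑ i ∈ Finset.univ.filter (fun i : Fin n => i ≠ 0), w i * s i
      + t ^ 2 * ∑ i ∈ Finset.univ.filter (fun i : Fin n => i ≠ 0), s i * s i := by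
    rw [Finset.mul_sum, Finset.mul_sum, ← Finset.sum_add_distrib, ← Finset.sum_add_distrib]
    refine Finset.sum_congr rfl fun i _ => ?_
    simp only [Pi.add_apply, Pi.smul_apply, smul_eq_mul]
    ring
  unfold eta
  rw [h]
  simp only [Pi.add_apply, Pi.smul_apply, smul_eq_mul]
  ring

lemma eta_smul (s : Fin n → ℝ) (t : ℝ) : eta (t • s) (t • s) = t ^ 2 * eta s s := by
  have := eta_add_smul 0 s t
  simpa [eta] using this

lemma eta_neg_neg (s : Fin n → ℝ) : eta (-s) (-s) = eta s s := by
  simp [eta]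

lemma eta_nonneg_of_future {u v : Fin n → ℝ} (hu : 0 ≤ eta u u) (hv : 0 ≤ eta v v)
    (hu0 : 0 ≤ u 0) (hv0 : 0 ≤ v 0) : 0 ≤ eta u v := by
  unfold eta at *
  have h := Finset.sum_mul_sq_le_sq_mul_sq (Finset.univ.filter (fun i : Fin n => i ≠ 0)) u v
  simp only [pow_two (u _), pow_two (v _)] at h
  have hv' : 0 ≤ ∑ i ∈ Finset.univ.filter (fun i : Fin n => i ≠ 0), v i * v i :=
    Finset.sum_nonneg fun i _ => mul_self_nonneg _
  have h2 := mul_le_mul (sub_nonneg.1 hu) (sub_nonneg.1 hv) hv' (mul_self_nonneg _)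
  have := abs_le_of_sq_le_sq (a := ∑ i ∈ Finset.univ.filter (fun i : Fin n => i ≠ 0), u i * v i)
    (b := u 0 * v 0) (by nlinarith) (by positivity)
  linarith [(abs_le.1 this).2]

lemma cone_comb {u v : Fin n → ℝ} (hu : 0 ≤ eta u u) (hv : 0 ≤ eta v v)
    (hu0 : 0 ≤ u 0) (hv0 : 0 ≤ v 0) {a b : ℝ} (ha : 0 ≤ a) (hb : 0 ≤ b) :
    0 ≤ eta (a • u + b • v) (a • u + b • v) := by
  rw [eta_add_smul, eta_smul]
  have h1 : 0 ≤ eta (a • u) v := by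
    refine eta_nonneg_of_future ?_ hv ?_ hv0
    · rw [eta_smul]; positivity
    · simpa using mul_nonneg ha hu0
  positivity

lemma eta_spatial_neg {s : Fin n → ℝ} (h0 : s 0 = 0) (hs : s ≠ 0) : eta s s < 0 := by
  obtain ⟨i, hi⟩ := Function.ne_iff.1 hs
  have hi0 : i ≠ 0 := by rintro rfl; exact hi h0
  have : 0 < ∑ i ∈ Finset.univ.filter (fun i : Fin n => i ≠ 0), s i * s i :=
    Finset.sum_pos' (fun i _ => mul_self_nonneg _)
      ⟨i, by simp [hi0], mul_self_pos.2 hi⟩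
  unfold eta
  rw [h0]
  linarith

lemma eq_zero_of_time_zero {s : Fin n → ℝ} (h0 : s 0 = 0) (hs : 0 ≤ eta s s) : s = 0 := by
  by_contra h
  linarith [eta_spatial_neg h0 h]

lemma exists_root {w s : Fin n → ℝ} (hw : 0 ≤ eta w w) (hs : eta s s < 0) :
    ∃ t : ℝ, 0 ≤ t ∧ eta (w + t • s) (w + t • s) = 0 := by
  set A := eta w w
  set B := eta w s with hB
  set C := eta s s with hC
  have hD : 0 ≤ B ^ 2 - A * C := by nlinarith [sq_nonneg B]
  have hq := Real.sq_sqrt hD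
  set q := Real.sqrt (B ^ 2 - A * C)
  have hqB : 0 ≤ B + q := by
    have : |B| ≤ q := Real.abs_le_sqrt (by nlinarith)
    linarith [neg_abs_le B]
  refine ⟨(B + q) / (-C), div_nonneg hqB (by linarith), ?_⟩
  rw [eta_add_smul]
  change A + 2 * _ * B + _ * C = 0
  have : C ≠ 0 := hs.ne
  field_simp
  linear_combination hq

lemma time_ne_zero (hn : 3 ≤ n) (L : (Fin n → ℝ) →ₗ[ℝ] (Fin n → ℝ))
    (hL : Function.Injective L) (hnull : ∀ k, IsNull k → 0 ≤ eta (L k) (L k))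
    {u : Fin n → ℝ} (hu : 0 ≤ eta u u) (hu0 : 0 < u 0) : (L u) 0 ≠ 0 := by
  intro hf
  obtain ⟨s, hs0, hs, hfs⟩ : ∃ s : Fin n → ℝ, s 0 = 0 ∧ s ≠ 0 ∧ (L s) 0 = 0 := by
    let i : Fin n := ⟨1, by omega⟩
    let j : Fin n := ⟨2, by omega⟩
    have hi : i ≠ 0 := by intro h; have := congrArg Fin.val h; simp [i] at this
    have hj : j ≠ 0 := by intro h; have := congrArg Fin.val h; simp [j] at this
    have hij : i ≠ j := by intro h; have := congrArg Fin.val h; simp [i, j] at this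
    by_cases h : L (Pi.single i 1) 0 = 0
    · exact ⟨Pi.single i 1, by simp [hi.symm], by simp, h⟩
    · refine ⟨L (Pi.single j 1) 0 • Pi.single i 1 - L (Pi.single i 1) 0 • Pi.single j 1,
        by simp [hi.symm, hj.symm], ?_, ?_⟩
      · intro h'
        have := congrFun h' j
        simp [hij.symm] at this
        exact h this
      · simp only [map_sub, map_smul, Pi.sub_apply, Pi.smul_apply, smul_eq_mul]
        ring
  obtain ⟨t, -, ht⟩ := exists_root hu (eta_spatial_neg hs0 hs)
  have hne : u + t • s ≠ 0 := by
    intro h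
    have := congrFun h 0
    simp [hs0] at this
    linarith
  have h1 := hnull _ ⟨hne, ht⟩
  have h2 := eq_zero_of_time_zero (s := L (u + t • s)) (by simp [hf, hfs]) h1
  exact hne (hL (by rw [h2, map_zero]))

lemma main_aux (hn : 3 ≤ n) (L : (Fin n → ℝ) →ₗ[ℝ] (Fin n → ℝ))
    (hL : Function.Injective L) (hnull : ∀ k, IsNull k → 0 ≤ eta (L k) (L k))
    (he : 0 < L (Pi.single 0 1) 0) :
    ∀ u, FutureCausal u → FutureCausal (L u) := by
  have hpos : ∀ u : Fin n → ℝ, 0 ≤ eta u u → 0 < u 0 → 0 < L u 0 := by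
    intro u hu hu0
    by_contra hneg
    have hneg : L u 0 ≤ 0 := not_lt.1 hneg
    have hE : 0 ≤ eta (Pi.single 0 1 : Fin n → ℝ) (Pi.single 0 1) := by
      unfold eta
      rw [Finset.sum_eq_zero]
      · simp
      · intro i hi
        have : i ≠ 0 := by simpa using hi
        simp [this]
    have hc := cone_comb hu hE hu0.le (by simp) he.le (neg_nonneg.2 hneg)
    refine time_ne_zero hn L hL hnull hc ?_ ?_
    · have := mul_pos he hu0
      simp
      linarith
    · simp only [map_add, map_smul, Pi.add_apply, Pi.smul_apply, smul_eq_mul]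
      ring
  rintro u ⟨hu, hc, hu0⟩
  refine ⟨fun h => hu (hL (by rw [h, map_zero])), ?_, hpos u hc hu0⟩
  let i : Fin n := ⟨1, by omega⟩
  have hi : i ≠ 0 := by intro h; have := congrArg Fin.val h; simp [i] at this
  let s : Fin n → ℝ := Pi.single i 1
  have hs0 : s 0 = 0 := by simp [s, hi.symm]
  have hs : eta s s < 0 := eta_spatial_neg hs0 (by simp [s])
  obtain ⟨a, ha, ha'⟩ := exists_root hc hs
  obtain ⟨b, hb, hb'⟩ := exists_root (s := -s) hc (by rwa [eta_neg_neg])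
  have h1 : (u + a • s) 0 = u 0 := by simp [hs0]
  have h2 : (u + b • -s) 0 = u 0 := by simp [hs0]
  have hn1 := hnull (u + a • s) ⟨fun h => by rw [h] at h1; simp at h1; linarith, ha'⟩
  have hn2 := hnull (u + b • -s) ⟨fun h => by rw [h] at h2; simp at h2; linarith, hb'⟩
  have hp1 := hpos (u + a • s) ha'.ge (by rwa [h1])
  have hp2 := hpos (u + b • -s) hb'.ge (by rwa [h2])
  rcases ha.eq_or_lt with rfl | hapos
  · simpa using hn1
  have := cone_comb hn1 hn2 hp1.le hp2.le hb ha
  have e : b • L (u + a • s) + a • L (u + b • -s) = (a + b) • L u := by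
    simp only [map_add, map_smul, map_neg]
    module
  rw [e, eta_smul] at this
  exact nonneg_of_mul_nonneg_right this (by positivity)

end helpers

/-- A bijective linear map taking every null vector to a causal (or zero) vector is
either a causal or an anticausal map of the cone. -/
theorem stmt_1 {n : ℕ} [NeZero n] (hn : 3 ≤ n)
    (L : (Fin n → ℝ) →ₗ[ℝ] (Fin n → ℝ)) (hL : Function.Bijective L)
    (hnull : ∀ k, IsNull k → 0 ≤ eta (L k) (L k)) :
    (∀ u, FutureCausal u → FutureCausal (L u)) ∨
    (∀ u, FutureCausal u → FutureCausal (-(L u))) := by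
  have hE : 0 ≤ eta (Pi.single 0 1 : Fin n → ℝ) (Pi.single 0 1) := by
    unfold eta
    rw [Finset.sum_eq_zero]
    · simp
    · intro i hi
      have : i ≠ 0 := by simpa using hi
      simp [this]
  rcases lt_or_gt_of_ne (time_ne_zero hn L hL.1 hnull hE (by simp)) with h | h
  · right
    refine main_aux hn (-L) (fun x y hxy => hL.1 (neg_injective hxy)) ?_ ?_
    · intro k hk
      rw [LinearMap.neg_apply, eta_neg_neg]
      exact hnull k hk
    · simpa using h
  · left
    exact main_aux hn L hL.1 hnull h
end

section
/- Let n ≥ 3 and let L : ℝⁿ → ℝⁿ be a bijective linear map. Then η(L u, L v) ≥ 0 for all u, v ∈ Θ⁺ (i.e. the pullback of η under L is a future tensor) if and only if either L u ∈ Θ⁺ for every u ∈ Θ⁺, or −L u ∈ Θ⁺ for every u ∈ Θ⁺. -/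
open Finset

theorem eta_nonneg_aux {n : ℕ} [NeZero n] {u v : Fin n → ℝ} (hu : FutureCausal u)
    (hv : FutureCausal v) : 0 ≤ eta u v := by
  obtain ⟨-, hu1, hu0⟩ := hu
  obtain ⟨-, hv1, hv0⟩ := hv
  unfold eta at *
  have h := Finset.sum_mul_sq_le_sq_mul_sq (Finset.univ.filter (fun i : Fin n => i ≠ 0)) u v
  simp only [← pow_two] at hu1 hv1
  have h2 := mul_le_mul (sub_nonneg.mp hu1) (sub_nonneg.mp hv1)
    (Finset.sum_nonneg fun i _ => sq_nonneg (v i)) (sq_nonneg (u 0))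
  have h3 : (∑ i ∈ Finset.univ.filter (fun i : Fin n => i ≠ 0), u i * v i) ^ 2
      ≤ (u 0 * v 0) ^ 2 := by
    rw [mul_pow]; exact h.trans h2
  have := abs_le_of_sq_le_sq' h3 (mul_pos hu0 hv0).le
  linarith [this.2]

theorem time_ne_aux {n : ℕ} [NeZero n] {u : Fin n → ℝ} (hu : u ≠ 0)
    (h : 0 ≤ eta u u) : u 0 ≠ 0 := by
  intro h0
  apply hu
  unfold eta at h
  rw [h0] at h
  have hs : ∑ i ∈ Finset.univ.filter (fun i : Fin n => i ≠ 0), u i * u i = 0 :=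
    le_antisymm (by linarith) (Finset.sum_nonneg fun i _ => mul_self_nonneg (u i))
  rw [Finset.sum_eq_zero_iff_of_nonneg (fun i _ => mul_self_nonneg (u i))] at hs
  funext i
  by_cases hi : i = 0
  · rw [hi, h0]; rfl
  · exact mul_self_eq_zero.mp (hs i (by simp [hi]))

theorem eta_neg_neg_aux {n : ℕ} [NeZero n] (u v : Fin n → ℝ) : eta (-u) (-v) = eta u v := by
  simp [eta]

theorem shift_aux {n : ℕ} [NeZero n] {u : Fin n → ℝ} (hu : FutureCausal u) {s : ℝ}
    (hs : 0 ≤ s) : FutureCausal (u + s • Pi.single (0 : Fin n) (1 : ℝ)) := by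
  obtain ⟨-, h1, h0⟩ := hu
  have ht : 0 < (u + s • Pi.single (0 : Fin n) (1 : ℝ) : Fin n → ℝ) 0 := by simp; linarith
  refine ⟨fun h => by rw [h] at ht; simp at ht, ?_, ht⟩
  unfold eta at *
  have : ∑ i ∈ Finset.univ.filter (fun i : Fin n => i ≠ 0),
      (u + s • Pi.single (0 : Fin n) (1 : ℝ) : Fin n → ℝ) i * (u + s • Pi.single (0 : Fin n) (1 : ℝ) : Fin n → ℝ) i
      = ∑ i ∈ Finset.univ.filter (fun i : Fin n => i ≠ 0), u i * u i := by
    apply Finset.sum_congr rfl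
    intro i hi
    have hi' : i ≠ 0 := by simpa using hi
    simp [hi']
  rw [this]
  simp only [Pi.add_apply, Pi.smul_apply, Pi.single_eq_same, smul_eq_mul, mul_one]
  nlinarith [mul_nonneg hs h0.le, mul_nonneg hs hs]

theorem stmt_2 {n : ℕ} [NeZero n] (hn : 3 ≤ n)
    (L : (Fin n → ℝ) →ₗ[ℝ] (Fin n → ℝ)) (hL : Function.Bijective L) :
    (∀ u v, FutureCausal u → FutureCausal v → 0 ≤ eta (L u) (L v)) ↔
      ((∀ u, FutureCausal u → FutureCausal (L u)) ∨
       (∀ u, FutureCausal u → FutureCausal (-(L u)))) := by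
  constructor
  · intro H
    have hne : ∀ u, FutureCausal u → L u ≠ 0 := fun u hu h =>
      hu.1 (hL.1 (by rw [h, map_zero]))
    have ht : ∀ u, FutureCausal u → L u 0 ≠ 0 := fun u hu =>
      time_ne_aux (hne u hu) (H u u hu hu)
    have he : FutureCausal (Pi.single (0 : Fin n) (1 : ℝ)) := by
      refine ⟨by simp, ?_, by simp⟩
      unfold eta
      rw [Finset.sum_eq_zero]
      · simp
      · intro i hi
        have hi' : i ≠ 0 := by simpa using hi
        simp [hi']
    have key : ∀ u, FutureCausal u → 0 < L u 0 * L (Pi.single (0 : Fin n) (1 : ℝ)) 0 := by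
      intro u hu
      by_contra hc
      push Not at hc
      have e0 := ht _ he
      set a := L (Pi.single (0 : Fin n) (1 : ℝ)) 0 with ha
      have hs : 0 ≤ -(L u 0 * a) / a ^ 2 := div_nonneg (by linarith) (sq_nonneg a)
      apply ht _ (shift_aux hu hs)
      rw [map_add, map_smul, Pi.add_apply, Pi.smul_apply, ← ha, smul_eq_mul]
      field_simp
      ring
    rcases lt_or_gt_of_ne (ht _ he) with h | h
    · right
      intro u hu
      refine ⟨neg_ne_zero.mpr (hne u hu), ?_, ?_⟩
      · rw [eta_neg_neg_aux]; exact H u u hu hu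
      · rw [Pi.neg_apply]; linarith [neg_of_mul_pos_left (key u hu) h.le]
    · left
      intro u hu
      exact ⟨hne u hu, H u u hu hu, pos_of_mul_pos_left (key u hu) h.le⟩
  · rintro (H | H) u v hu hv
    · exact eta_nonneg_aux (H u hu) (H v hv)
    · rw [← eta_neg_neg_aux]
      exact eta_nonneg_aux (H u hu) (H v hv)
end

section
/- Let n ≥ 2 and let L : ℝⁿ → ℝⁿ be an injective linear map such that L u ∈ Θ⁺ for every u ∈ Θ⁺. Then: (i) if u ∈ Θ⁺ is timelike, then L u is timelike; (ii) if u ∈ Θ⁺ and L u is null, then u is null. -/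
open Finset

/-- A causal-cone-preserving injective linear map sends future timelike vectors to
timelike vectors, and if the image of a future causal vector is null then the
vector itself was null. -/
theorem stmt_4 {n : ℕ} [NeZero n] (hn : 2 ≤ n)
    (L : (Fin n → ℝ) →ₗ[ℝ] (Fin n → ℝ)) (hL : Function.Injective L)
    (hcaus : ∀ u, FutureCausal u → FutureCausal (L u)) :
    (∀ u, FutureCausal u → 0 < eta u u → 0 < eta (L u) (L u)) ∧
    (∀ u, FutureCausal u → eta (L u) (L u) = 0 → eta u u = 0) := by
  have key : ∀ u, FutureCausal u → 0 < eta u u → 0 < eta (L u) (L u) := by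
    intro u hu hpos
    obtain ⟨_, h0, h1⟩ := hcaus u hu
    rcases h0.lt_or_eq with h | h
    · exact h
    exfalso
    obtain ⟨v, hv⟩ := (LinearMap.injective_iff_surjective.mp hL) (Pi.single 0 1)
    have c1 : Continuous fun e : ℝ => eta (u - e • v) (u - e • v) := by
      unfold eta
      simp only [Pi.sub_apply, Pi.smul_apply, smul_eq_mul]
      fun_prop
    have c2 : Continuous fun e : ℝ => (u - e • v) 0 := by
      simp only [Pi.sub_apply, Pi.smul_apply, smul_eq_mul]
      fun_prop
    have e1 : ∀ᶠ e in nhds (0 : ℝ), 0 < eta (u - e • v) (u - e • v) :=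
      c1.continuousAt.eventually (lt_mem_nhds (by simpa using hpos))
    have e2 : ∀ᶠ e in nhds (0 : ℝ), 0 < (u - e • v) 0 :=
      c2.continuousAt.eventually (lt_mem_nhds (by simpa using hu.2.2))
    obtain ⟨e, ⟨f1, f2⟩, he⟩ :=
      (((e1.and e2).filter_mono nhdsWithin_le_nhds).and
        (self_mem_nhdsWithin : Set.Ioi (0 : ℝ) ∈ nhdsWithin 0 (Set.Ioi 0))).exists
    have he' : 0 < e := he
    have hne : u - e • v ≠ 0 := by
      intro hz
      rw [hz] at f2
      simp at f2
    obtain ⟨_, g1, g2⟩ := hcaus _ ⟨hne, f1.le, f2⟩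
    rw [map_sub, map_smul, hv] at g1 g2
    have hx : (L u - e • (Pi.single 0 1 : Fin n → ℝ)) 0 = L u 0 - e := by simp
    have hs : ∑ i ∈ Finset.univ.filter (fun i : Fin n => i ≠ 0),
        (L u - e • (Pi.single 0 1 : Fin n → ℝ)) i * (L u - e • (Pi.single 0 1 : Fin n → ℝ)) i
        = ∑ i ∈ Finset.univ.filter (fun i : Fin n => i ≠ 0), L u i * L u i := by
      refine Finset.sum_congr rfl fun i hi => ?_
      have : i ≠ 0 := (Finset.mem_filter.mp hi).2
      simp [Pi.single_eq_of_ne this]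
    unfold eta at g1 h
    rw [hs, hx] at g1
    rw [hx] at g2
    nlinarith [mul_pos he' g2, mul_pos he' h1]
  refine ⟨key, fun u hu h => ?_⟩
  rcases hu.2.1.lt_or_eq with h' | h'
  · exact absurd h (key u hu h').ne'
  · exact h'.symm
end

section
/- Let n ≥ 2, let B be a symmetric future tensor (bilinear form) on ℝⁿ, and let k ∈ ∂Θ⁺. Then B♯k is either zero or a future-directed causal vector, and η(B♯k, B♯k) = 0 if and only if B♯k = 0 or B♯k ∈ ∂Θ⁺. (Equivalently, the set of null directions σ(B) = {k ∈ ∂Θ⁺ : B♯k ∈ ∂Θ⁺ ∪ {0}} coincides with the set of principal directions of the tensor B ×₁ B, where (B ×₁ B)(u,v) = η(B♯u, B♯v).) -/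
open Finset

lemma dual_cone {n : ℕ} [NeZero n] (w : Fin n → ℝ)
    (h : ∀ v, FutureCausal v → 0 ≤ eta w v) : w = 0 ∨ FutureCausal w := by
  set S : ℝ := ∑ i ∈ Finset.univ.filter (fun i : Fin n => i ≠ 0), w i * w i with hS
  have hS0 : 0 ≤ S := Finset.sum_nonneg fun i _ => mul_self_nonneg (w i)
  have hss : Real.sqrt S * Real.sqrt S = S := Real.mul_self_sqrt hS0
  have key : ∀ t : ℝ, 0 < t → S ≤ t * t → S ≤ w 0 * t := by
    intro t ht hSt
    have h1 : ∑ i ∈ Finset.univ.filter (fun i : Fin n => i ≠ 0),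
        Function.update w 0 t i * Function.update w 0 t i = S := by
      refine Finset.sum_congr rfl fun i hi => ?_
      rw [Function.update_of_ne (Finset.mem_filter.1 hi).2]
    have h2 : ∑ i ∈ Finset.univ.filter (fun i : Fin n => i ≠ 0),
        w i * Function.update w 0 t i = S := by
      refine Finset.sum_congr rfl fun i hi => ?_
      rw [Function.update_of_ne (Finset.mem_filter.1 hi).2]
    have h3 := h (Function.update w 0 t) ⟨fun h0 => by
        have := congrFun h0 0
        simp at this
        exact ht.ne' this, by
        unfold eta
        rw [h1, Function.update_self]
        linarith, by simpa using ht⟩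
    unfold eta at h3
    rw [h2, Function.update_self] at h3
    linarith
  have hww : eta w w = w 0 * w 0 - S := rfl
  have hz : S = 0 → w 0 = 0 → w = 0 := by
    intro hS1 hw0
    funext i
    by_cases hi : i = 0
    · rw [hi, hw0]; rfl
    · have := (Finset.sum_eq_zero_iff_of_nonneg
        (fun i _ => mul_self_nonneg (w i))).1 (hS.symm.trans hS1) i (by simp [hi])
      simpa using this
  have hle : Real.sqrt S ≤ w 0 := by
    rcases hS0.eq_or_lt with h0 | hpos
    · rw [← h0, Real.sqrt_zero]
      have := key 1 one_pos (by rw [← h0]; norm_num)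
      linarith
    · have hs := Real.sqrt_pos.2 hpos
      have := key _ hs hss.ge
      nlinarith
  have hs0 := Real.sqrt_nonneg S
  rcases (hs0.trans hle).eq_or_lt with h0 | hpos
  · left
    have : Real.sqrt S = 0 := le_antisymm (h0 ▸ hle) hs0
    exact hz (by rw [← hss, this, mul_zero]) h0.symm
  · right
    refine ⟨fun h0 => ?_, ?_, hpos⟩
    · rw [h0] at hpos; simp at hpos
    · rw [hww]; nlinarith

/-- For a symmetric future tensor `B` and a future null `k`, `B♯k` is zero or future
causal, and `η(B♯k,B♯k) = 0` iff `B♯k` is zero or future null (so that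
`σ(B) = μ(B ×₁ B)`). -/
theorem stmt_10 {n : ℕ} [NeZero n] (hn : 2 ≤ n)
    (B : (Fin n → ℝ) →ₗ[ℝ] (Fin n → ℝ) →ₗ[ℝ] ℝ)
    (hsym : ∀ u v, B u v = B v u)
    (hfut : ∀ u v, FutureCausal u → FutureCausal v → 0 ≤ B u v)
    (Bsharp : (Fin n → ℝ) →ₗ[ℝ] (Fin n → ℝ))
    (hBsharp : ∀ u v, eta (Bsharp u) v = B u v) :
    ∀ k, FutureNull k →
      (Bsharp k = 0 ∨ FutureCausal (Bsharp k)) ∧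
      (eta (Bsharp k) (Bsharp k) = 0 ↔ (Bsharp k = 0 ∨ FutureNull (Bsharp k))) := by
  intro k hk
  have h := dual_cone (Bsharp k) (fun v hv => by
    rw [hBsharp]; exact hfut k v ⟨hk.1, hk.2.1.ge, hk.2.2⟩ hv)
  refine ⟨h, fun h0 => ?_, ?_⟩
  · rcases h with h | h
    · exact Or.inl h
    · exact Or.inr ⟨h.1, h0, h.2.2⟩
  · rintro (h | h)
    · rw [h]; simp [eta]
    · exact h.2.1
end

section
/- Let n ≥ 2 and let T be a bilinear form on ℝⁿ satisfying the strict null convergence condition: T(k,k) > 0 for every null vector k. Then there exists a constant b > 0 such that the symmetrized form plus b·η is a future tensor, i.e. ½(T(u,v) + T(v,u)) + b·η(u,v) ≥ 0 for all u,v ∈ Θ⁺. -/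
open Finset

lemma eta_smul_smul {n : ℕ} [NeZero n] (a b : ℝ) (u v : Fin n → ℝ) :
    eta (a • u) (b • v) = a * b * eta u v := by
  simp only [eta, Pi.smul_apply, smul_eq_mul, mul_sub, Finset.mul_sum]
  congr 1
  · ring
  · exact Finset.sum_congr rfl fun i _ => by ring

lemma two_eta {n : ℕ} [NeZero n] (u v : Fin n → ℝ) (hu : u 0 = 1) (hv : v 0 = 1) :
    2 * eta u v = eta u u + eta v v
      + ∑ i ∈ Finset.univ.filter (fun i => i ≠ 0), (u i - v i) ^ 2 := by
  have h : ∑ i ∈ Finset.univ.filter (fun i : Fin n => i ≠ 0), (u i - v i) ^ 2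
      = ∑ i ∈ Finset.univ.filter (fun i : Fin n => i ≠ 0), u i * u i
      + ∑ i ∈ Finset.univ.filter (fun i : Fin n => i ≠ 0), v i * v i
      - 2 * ∑ i ∈ Finset.univ.filter (fun i : Fin n => i ≠ 0), u i * v i := by
    rw [Finset.mul_sum, ← Finset.sum_add_distrib, ← Finset.sum_sub_distrib]
    exact Finset.sum_congr rfl fun i _ => by ring
  rw [h]
  simp only [eta, hu, hv]
  ring

lemma continuous_eta {n : ℕ} [NeZero n] :
    Continuous (fun p : (Fin n → ℝ) × (Fin n → ℝ) => eta p.1 p.2) := by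
  unfold eta
  fun_prop

lemma compact_slice {n : ℕ} [NeZero n] :
    IsCompact {u : Fin n → ℝ | u 0 = 1 ∧ 0 ≤ eta u u} := by
  refine (isCompact_Icc (a := fun _ : Fin n => (-1 : ℝ)) (b := fun _ => 1)).of_isClosed_subset
    ?_ ?_
  · have hc : Continuous (fun u : Fin n → ℝ => eta u u) :=
      continuous_eta.comp (continuous_id.prodMk continuous_id)
    rw [Set.setOf_and]
    exact (isClosed_eq (continuous_apply 0) continuous_const).inter
      (isClosed_le continuous_const hc)
  · rintro u ⟨h0, h⟩
    have key : ∀ i, |u i| ≤ 1 := by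
      intro i
      by_cases hi : i = 0
      · simp [hi, h0]
      · have h1 := Finset.single_le_sum (f := fun i => u i * u i)
          (s := Finset.univ.filter (fun i : Fin n => i ≠ 0))
          (fun i _ => mul_self_nonneg (u i)) (a := i) (by simp [hi])
        simp only [eta, h0] at h
        rw [← sq_le_one_iff_abs_le_one]
        nlinarith
    exact ⟨fun i => (abs_le.1 (key i)).1, fun i => (abs_le.1 (key i)).2⟩

/-- A tensor satisfying the strict null convergence condition becomes a future
tensor after adding a suitable positive multiple of the metric to its
symmetric part. -/
theorem stmt_14 {n : ℕ} [NeZero n] (hn : 2 ≤ n)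
    (T : (Fin n → ℝ) →ₗ[ℝ] (Fin n → ℝ) →ₗ[ℝ] ℝ)
    (hncc : ∀ k, IsNull k → 0 < T k k) :
    ∃ b : ℝ, 0 < b ∧
      ∀ u v, FutureCausal u → FutureCausal v →
        0 ≤ (T u v + T v u) / 2 + b * eta u v := by
  set S : Set (Fin n → ℝ) := {u | u 0 = 1 ∧ 0 ≤ eta u u} with hS
  let f : (Fin n → ℝ) × (Fin n → ℝ) → ℝ := fun p => (T p.1 p.2 + T p.2 p.1) / 2
  have hT : Continuous (fun p : (Fin n → ℝ) × (Fin n → ℝ) => T p.1 p.2) := by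
    have : (fun p : (Fin n → ℝ) × (Fin n → ℝ) => T p.1 p.2) =
        fun p => ∑ i, p.1 i * T (Pi.single i 1) p.2 := by
      funext p
      conv_lhs => rw [pi_eq_sum_univ' p.1]
      simp [map_sum, LinearMap.sum_apply, Pi.single_apply, eq_comm, Pi.single, Function.update]
      try rfl
    rw [this]
    refine continuous_finsetSum _ fun i _ => ?_
    exact ((continuous_apply i).comp continuous_fst).mul
      ((LinearMap.continuous_of_finiteDimensional _).comp continuous_snd)
  have hf : Continuous f := (hT.add (hT.comp continuous_swap)).div_const 2
  have hK : IsCompact (S ×ˢ S) := compact_slice.prod compact_slice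
  have hg : ∀ p ∈ S ×ˢ S, 0 ≤ eta p.1 p.2 := by
    rintro ⟨u, v⟩ ⟨⟨hu, hu'⟩, ⟨hv, hv'⟩⟩
    have := two_eta u v hu hv
    have h2 : 0 ≤ ∑ i ∈ Finset.univ.filter (fun i : Fin n => i ≠ 0), (u i - v i) ^ 2 :=
      Finset.sum_nonneg fun i _ => sq_nonneg _
    simp only at hu' hv' ⊢
    linarith
  have hgf : ∀ p ∈ S ×ˢ S, f p ≤ 0 → 0 < eta p.1 p.2 := by
    rintro ⟨u, v⟩ hp hle
    refine lt_of_le_of_ne (hg _ hp) fun h0 => ?_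
    obtain ⟨⟨hu, hu'⟩, ⟨hv, hv'⟩⟩ := hp
    have := two_eta u v hu hv
    have hnn : ∀ i ∈ Finset.univ.filter (fun i : Fin n => i ≠ 0), 0 ≤ (u i - v i) ^ 2 :=
      fun i _ => sq_nonneg _
    have h2 := Finset.sum_nonneg hnn
    simp only at hu' hv' h0 hu hv
    have h3 : ∑ i ∈ Finset.univ.filter (fun i : Fin n => i ≠ 0), (u i - v i) ^ 2 = 0 := by
      linarith
    have h4 : eta u u = 0 := by linarith
    have h5 : u = v := by
      funext i
      by_cases hi : i = 0
      · rw [hi, hu, hv]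
      · have := (Finset.sum_eq_zero_iff_of_nonneg hnn).1 h3 i (by simp [hi])
        exact sub_eq_zero.1 (pow_eq_zero_iff (two_ne_zero) |>.1 this)
    subst h5
    have := hncc u ⟨fun h => by simp [h] at hu, h4⟩
    simp only [f] at hle
    linarith
  have main : ∃ b : ℝ, 0 < b ∧ ∀ p ∈ S ×ˢ S, 0 ≤ f p + b * eta p.1 p.2 := by
    have hK' : IsCompact ((S ×ˢ S) ∩ {p | f p ≤ 0}) :=
      hK.inter_right (isClosed_le hf continuous_const)
    rcases ((S ×ˢ S) ∩ {p | f p ≤ 0}).eq_empty_or_nonempty with he | hne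
    · refine ⟨1, one_pos, fun p hp => ?_⟩
      have h1 : 0 < f p := by
        by_contra h
        have : p ∈ (S ×ˢ S) ∩ {p | f p ≤ 0} := ⟨hp, not_lt.1 h⟩
        simp [he] at this
      have := hg p hp
      linarith
    · obtain ⟨q, hq, hqmin⟩ := hK'.exists_isMinOn hne continuous_eta.continuousOn
      obtain ⟨r, hr, hrmin⟩ := hK'.exists_isMinOn hne hf.continuousOn
      have hc := hgf q hq.1 hq.2
      have hr0 : f r ≤ 0 := hr.2
      refine ⟨(1 - f r) / eta q.1 q.2, by apply div_pos <;> linarith, fun p hp => ?_⟩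
      have hb : 0 < (1 - f r) / eta q.1 q.2 := by apply div_pos <;> linarith
      by_cases h : f p ≤ 0
      · have h1 : eta q.1 q.2 ≤ eta p.1 p.2 := hqmin ⟨hp, h⟩
        have h2 : f r ≤ f p := hrmin ⟨hp, h⟩
        have h3 := mul_le_mul_of_nonneg_left h1 hb.le
        rw [div_mul_cancel₀ _ hc.ne'] at h3
        linarith
      · have := mul_nonneg hb.le (hg p hp)
        linarith
  obtain ⟨b, hb, hmain⟩ := main
  refine ⟨b, hb, fun u v hu hv => ?_⟩
  have norm : ∀ w : Fin n → ℝ, FutureCausal w → (w 0)⁻¹ • w ∈ S := by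
    rintro w ⟨-, h1, h2⟩
    refine ⟨by simp [h2.ne'], ?_⟩
    rw [eta_smul_smul]
    positivity
  have h := hmain (_, _) ⟨norm u hu, norm v hv⟩
  have hu0 := hu.2.2
  have hv0 := hv.2.2
  simp only [f, eta_smul_smul, map_smul, LinearMap.smul_apply, smul_eq_mul] at h
  have h' := mul_nonneg (mul_pos hu0 hv0).le h
  have e : u 0 * v 0 * (((v 0)⁻¹ * ((u 0)⁻¹ * T u v) + (u 0)⁻¹ * ((v 0)⁻¹ * T v u)) / 2
      + b * ((u 0)⁻¹ * (v 0)⁻¹ * eta u v)) = (T u v + T v u) / 2 + b * eta u v := by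
    field_simp
  exact e ▸ h'
end

section
/- Let n ≥ 2 and let λ : Fin n → ℝ. Define the diagonal bilinear form B on ℝⁿ by B(u,v) = λ(0)·u 0·v 0 − ∑_{i=1}^{n-1} λ(i)·u i·v i (so B is diagonal in an η-orthonormal basis with timelike eigenvalue λ(0) and spacelike eigenvalues λ(i)). Then B is a future tensor, i.e. B(u,v) ≥ 0 for all u,v ∈ Θ⁺, if and only if |λ(i)| ≤ λ(0) for every i with 1 ≤ i ≤ n−1. -/
open Finset

/-- A diagonal (in an η-orthonormal basis) symmetric tensor is a future tensor iff
the absolute value of each spacelike eigenvalue is bounded by the timelike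
eigenvalue. -/
theorem stmt_17 {n : ℕ} [NeZero n] (hn : 2 ≤ n) (lam : Fin n → ℝ) :
    (∀ u v, FutureCausal u → FutureCausal v →
        0 ≤ lam 0 * u 0 * v 0 -
          ∑ i ∈ Finset.univ.filter (fun i => i ≠ 0), lam i * u i * v i) ↔
      (∀ i : Fin n, i ≠ 0 → |lam i| ≤ lam 0) := by
  constructor
  · intro h i hi
    -- the test vectors `e₀ + s eᵢ`
    have hf : ∀ s : ℝ, s ^ 2 = 1 → FutureCausal (fun j : Fin n => if j = 0 then (1 : ℝ) else if j = i then s else 0) := by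
      intro s hs
      refine ⟨fun h0 => ?_, ?_, ?_⟩
      · have := congrFun h0 0
        simp at this
      · have hsum : ∑ j ∈ Finset.univ.filter (fun j : Fin n => j ≠ 0),
            (if j = 0 then (1 : ℝ) else if j = i then s else 0) *
            (if j = 0 then (1 : ℝ) else if j = i then s else 0) = s * s := by
          rw [Finset.sum_eq_single i]
          · simp [hi]
          · intro b hb hbi
            have hb0 : b ≠ 0 := by simpa using hb
            simp [hb0, hbi]
          · intro hni
            simp [hi] at hni
        simp only [eta]
        rw [hsum]
        simp only [if_true]
        nlinarith
      · simp
    have key : ∀ s t : ℝ, s ^ 2 = 1 → t ^ 2 = 1 → 0 ≤ lam 0 - lam i * s * t := by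
      intro s t hs ht
      have h1 := h _ _ (hf s hs) (hf t ht)
      have hsum : ∑ j ∈ Finset.univ.filter (fun j : Fin n => j ≠ 0),
            lam j * (if j = 0 then (1 : ℝ) else if j = i then s else 0) *
            (if j = 0 then (1 : ℝ) else if j = i then t else 0) = lam i * s * t := by
        rw [Finset.sum_eq_single i]
        · simp [hi]
        · intro b hb hbi
          have hb0 : b ≠ 0 := by simpa using hb
          simp [hb0, hbi]
        · intro hni
          simp [hi] at hni
      rw [hsum] at h1
      simpa using h1
    have k1 := key 1 1 (by norm_num) (by norm_num)
    have k2 := key 1 (-1) (by norm_num) (by norm_num)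
    rw [abs_le]
    constructor <;> linarith
  · intro h u v hu hv
    obtain ⟨-, hu1, hu0⟩ := hu
    obtain ⟨-, hv1, hv0⟩ := hv
    have hl : 0 ≤ lam 0 := by
      have := h ⟨1, by omega⟩ (by
        intro h0
        have := congrArg Fin.val h0
        simp at this)
      exact (abs_nonneg _).trans this
    unfold eta at hu1 hv1
    set S := Finset.univ.filter (fun i : Fin n => i ≠ 0) with hS
    have hcs := Finset.sum_mul_sq_le_sq_mul_sq S (fun i => |u i|) (fun i => |v i|)
    simp only [sq_abs] at hcs
    have hU : ∑ i ∈ S, u i ^ 2 ≤ u 0 ^ 2 := by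
      simp only [pow_two]; linarith
    have hV : ∑ i ∈ S, v i ^ 2 ≤ v 0 ^ 2 := by
      simp only [pow_two]; linarith
    have hP : ∑ i ∈ S, |u i| * |v i| ≤ u 0 * v 0 := by
      refine (abs_le_of_sq_le_sq' ?_ (by positivity)).2
      calc _ ≤ _ := hcs
        _ ≤ u 0 ^ 2 * v 0 ^ 2 := by
          apply mul_le_mul hU hV (Finset.sum_nonneg fun i _ => sq_nonneg _) (sq_nonneg _)
        _ = _ := by ring
    have hB : ∑ i ∈ S, lam i * u i * v i ≤ lam 0 * ∑ i ∈ S, |u i| * |v i| := by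
      rw [Finset.mul_sum]
      apply Finset.sum_le_sum
      intro i hi
      have hi0 : i ≠ 0 := by simpa [hS] using hi
      calc lam i * u i * v i ≤ |lam i * u i * v i| := le_abs_self _
        _ = |lam i| * (|u i| * |v i|) := by rw [abs_mul, abs_mul, mul_assoc]
        _ ≤ _ := mul_le_mul_of_nonneg_right (h i hi0) (by positivity)
    have := mul_le_mul_of_nonneg_left hP hl
    linarith
end

section
/- Let n ≥ 2, let L : ℝⁿ → ℝⁿ be an injective linear map with L u ∈ Θ⁺ for every u ∈ Θ⁺, and let T be a symmetric future tensor (bilinear form) on ℝⁿ. Let B denote the pullback B(u,v) = T(L u, L v). Then either η(T♯u, T♯v) = 0 for all u,v (i.e. T ×₁ T = 0), or the following holds: every k ∈ ∂Θ⁺ with η(B♯k, B♯k) = 0 satisfies η(L k, L k) = 0 and η(T♯(L k), T♯(L k)) = 0; that is, σ(B) consists of canonical null directions of L and L maps σ(B) into σ(T). -/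
open Finset

section helpers
variable {n : ℕ} [NeZero n]

def spDot (u v : Fin n → ℝ) : ℝ := ∑ i ∈ Finset.univ.filter (fun i => i ≠ 0), u i * v i

lemma eta_eq (u v : Fin n → ℝ) : eta u v = u 0 * v 0 - spDot u v := rfl

lemma spDot_cs (u v : Fin n → ℝ) : spDot u v ^ 2 ≤ spDot u u * spDot v v := by
  have h := Finset.sum_mul_sq_le_sq_mul_sq (Finset.univ.filter (fun i : Fin n => i ≠ 0)) u v
  simpa [spDot, sq] using h

lemma spDot_nonneg (u : Fin n → ℝ) : 0 ≤ spDot u u :=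
  Finset.sum_nonneg (fun i _ => mul_self_nonneg (u i))

lemma eta_add_left (u v w : Fin n → ℝ) : eta (u + v) w = eta u w + eta v w := by
  simp only [eta, Pi.add_apply, add_mul, Finset.sum_add_distrib]; ring

lemma eta_comm (u v : Fin n → ℝ) : eta u v = eta v u := by
  simp only [eta, mul_comm]

lemma eta_smul_left (c : ℝ) (u w : Fin n → ℝ) : eta (c • u) w = c * eta u w := by
  simp only [eta, Pi.smul_apply, smul_eq_mul, mul_assoc, ← Finset.mul_sum]; ring

lemma eta_add_right (u v w : Fin n → ℝ) : eta w (u + v) = eta w u + eta w v := by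
  rw [eta_comm, eta_add_left, eta_comm u, eta_comm v]

lemma eta_smul_right (c : ℝ) (u w : Fin n → ℝ) : eta w (c • u) = c * eta w u := by
  rw [eta_comm, eta_smul_left, eta_comm u]

/-- The closed future cone. -/
def InCone (u : Fin n → ℝ) : Prop := 0 ≤ u 0 ∧ 0 ≤ eta u u

lemma cone_pair {a b : Fin n → ℝ} (ha : InCone a) (hb : InCone b) : 0 ≤ eta a b := by
  obtain ⟨ha0, ha⟩ := ha
  obtain ⟨hb0, hb⟩ := hb
  rw [eta_eq] at *
  have h1 := spDot_cs a b
  have h2 : spDot a a * spDot b b ≤ (a 0 * a 0) * (b 0 * b 0) :=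
    mul_le_mul (by linarith) (by linarith) (spDot_nonneg b) (mul_self_nonneg _)
  have h3 : spDot a b ≤ a 0 * b 0 :=
    le_of_sq_le_sq (by nlinarith) (mul_nonneg ha0 hb0)
  linarith

lemma cone_pair_strict {a b : Fin n → ℝ} (ha0 : 0 ≤ a 0) (ha : 0 < eta a a)
    (hb : FutureCausal b) : 0 < eta a b := by
  obtain ⟨-, hb, hb0⟩ := hb
  rw [eta_eq] at *
  have hs := spDot_nonneg a
  have h1 := spDot_cs a b
  have h2 : spDot a a * spDot b b ≤ spDot a a * (b 0 * b 0) :=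
    mul_le_mul_of_nonneg_left (by linarith) hs
  have h4 : spDot a a * (b 0 * b 0) < (a 0 * a 0) * (b 0 * b 0) :=
    mul_lt_mul_of_pos_right (by linarith) (by positivity)
  have h3 : spDot a b < a 0 * b 0 :=
    lt_of_pow_lt_pow_left₀ 2 (mul_nonneg ha0 hb0.le) (by nlinarith)
  linarith

lemma cone_dual {w : Fin n → ℝ} (h : ∀ v, FutureCausal v → 0 ≤ eta w v) : InCone w := by
  have key : ∀ s : ℝ, 0 < s → spDot w w ≤ s ^ 2 → spDot w w ≤ w 0 * s := by
    intro s hs hle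
    have hv0 : (Function.update w 0 s) 0 = s := by simp
    have hsp1 : spDot w (Function.update w 0 s) = spDot w w := by
      refine Finset.sum_congr rfl fun i hi => ?_
      rw [Function.update_of_ne (by simpa using hi)]
    have hsp2 : spDot (Function.update w 0 s) (Function.update w 0 s) = spDot w w := by
      refine Finset.sum_congr rfl fun i hi => ?_
      rw [Function.update_of_ne (by simpa using hi)]
    have := h (Function.update w 0 s) ⟨fun h0 => by rw [h0] at hv0; simp at hv0; linarith,
      by rw [eta_eq, hsp2, hv0]; nlinarith, by rw [hv0]; exact hs⟩
    rw [eta_eq, hsp1, hv0] at this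
    linarith
  have hn := spDot_nonneg w
  rcases hn.eq_or_lt with h0 | h0
  · have := key 1 one_pos (by rw [← h0]; norm_num)
    refine ⟨by linarith, ?_⟩
    rw [eta_eq, ← h0]
    nlinarith [mul_self_nonneg (w 0)]
  · have hs := Real.sqrt_pos.2 h0
    have hq := Real.sq_sqrt hn
    have := key _ hs hq.ge
    have h2 : √(spDot w w) ≤ w 0 := by
      by_contra hc
      push Not at hc
      nlinarith
    refine ⟨by linarith, ?_⟩
    rw [eta_eq]
    nlinarith

lemma exists_bound {x : Fin n → ℝ} (hx0 : 0 < x 0) (hx : 0 < eta x x) (u : Fin n → ℝ) :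
    ∃ c : ℝ, FutureCausal (c • x + u) ∧ FutureCausal (c • x + (-1 : ℝ) • u) := by
  have main : ∀ c : ℝ, 1 ≤ c → eta x x + 2 * |eta x u| + |eta u u| ≤ c * eta x x →
      |u 0| < c * x 0 → ∀ e : ℝ, (e = 1 ∨ e = -1) → FutureCausal (c • x + e • u) := by
    intro c hc h1 h2 e he
    have hpos : 0 < (c • x + e • u) 0 := by
      simp only [Pi.add_apply, Pi.smul_apply, smul_eq_mul]
      have := neg_abs_le (u 0)
      have := le_abs_self (u 0)
      rcases he with rfl | rfl <;> linarith
    refine ⟨fun h => by rw [h] at hpos; simp at hpos, ?_, hpos⟩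
    simp only [eta_add_left, eta_add_right, eta_smul_left, eta_smul_right, eta_comm u x]
    have a1 := neg_abs_le (eta x u)
    have a2 := le_abs_self (eta x u)
    have a3 := neg_abs_le (eta u u)
    have a4 := abs_nonneg (eta u u)
    have h3 := mul_le_mul_of_nonneg_left h1 (by linarith : 0 ≤ c)
    have h4 : |eta u u| ≤ c * |eta u u| := by nlinarith
    have h5 : -(c * |eta x u|) ≤ c * eta x u := by nlinarith
    have h6 : c * eta x u ≤ c * |eta x u| := by nlinarith
    have h7 : 0 < c * eta x x := by nlinarith
    rcases he with rfl | rfl <;> nlinarith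
  set p := (2 * |eta x u| + |eta u u|) / eta x x with hp
  set q := |u 0| / x 0 with hq
  have hp0 : 0 ≤ p := by positivity
  have hq0 : 0 ≤ q := by positivity
  have hpe : p * eta x x = 2 * |eta x u| + |eta u u| := div_mul_cancel₀ _ hx.ne'
  have hqe : q * x 0 = |u 0| := div_mul_cancel₀ _ hx0.ne'
  have m := main (1 + p + q) (by linarith) (by nlinarith) (by nlinarith)
  refine ⟨1 + p + q, ?_, m (-1) (Or.inr rfl)⟩
  simpa using m 1 (Or.inl rfl)

end helpers

/-- For a causal symmetry `L` and a symmetric future tensor `T` with pullback `B`,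
either `T ×₁ T = 0`, or the null directions of `B` are canonical null directions
of `L` and are mapped by `L` into the null directions of `T`. -/
theorem stmt_18 {n : ℕ} [NeZero n] (hn : 2 ≤ n)
    (L : (Fin n → ℝ) →ₗ[ℝ] (Fin n → ℝ)) (hL : Function.Injective L)
    (hcaus : ∀ u, FutureCausal u → FutureCausal (L u))
    (T : (Fin n → ℝ) →ₗ[ℝ] (Fin n → ℝ) →ₗ[ℝ] ℝ)
    (hsym : ∀ u v, T u v = T v u)
    (hfut : ∀ u v, FutureCausal u → FutureCausal v → 0 ≤ T u v)
    (Tsharp : (Fin n → ℝ) →ₗ[ℝ] (Fin n → ℝ))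
    (hTsharp : ∀ u v, eta (Tsharp u) v = T u v)
    (Bsharp : (Fin n → ℝ) →ₗ[ℝ] (Fin n → ℝ))
    (hBsharp : ∀ u v, eta (Bsharp u) v = T (L u) (L v)) :
    (∀ u v, eta (Tsharp u) (Tsharp v) = 0) ∨
    (∀ k, FutureNull k → eta (Bsharp k) (Bsharp k) = 0 →
      eta (L k) (L k) = 0 ∧ eta (Tsharp (L k)) (Tsharp (L k)) = 0) := by
  have hTc : ∀ u, FutureCausal u → InCone (Tsharp u) := fun u hu =>
    cone_dual fun v hv => by rw [hTsharp]; exact hfut u v hu hv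
  by_cases hex : ∃ x, 0 < x 0 ∧ 0 < eta x x ∧ eta (Tsharp x) (Tsharp x) = 0
  · left
    obtain ⟨x, hx0, hx, hw⟩ := hex
    have hnull : ∀ u, eta (Tsharp u) (Tsharp u) = 0 := by
      intro u
      obtain ⟨c, h1, h2⟩ := exists_bound hx0 hx u
      have c1 := hTc _ h1
      have c2 := hTc _ h2
      have h12 := cone_pair c1 c2
      have h11 := c1.2
      have h22 := c2.2
      simp only [map_add, map_smul, eta_add_left, eta_add_right, eta_smul_left,
        eta_smul_right, hw, eta_comm (Tsharp u) (Tsharp x)] at h12 h11 h22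
      linarith
    intro u v
    have h := hnull (u + v)
    simp only [map_add, eta_add_left, eta_add_right, hnull, eta_comm (Tsharp v) (Tsharp u)] at h
    linarith
  · right
    intro k hk hB
    have hkc : FutureCausal k := ⟨hk.1, hk.2.1.ge, hk.2.2⟩
    have hx := hcaus k hkc
    have hw := hTc _ hx
    have hrel : ∀ v, eta (Bsharp k) v = eta (Tsharp (L k)) (L v) := fun v => by
      rw [hBsharp, hTsharp]
    have hw0 : eta (Tsharp (L k)) (Tsharp (L k)) = 0 := by
      by_contra hne
      have hpos := lt_of_le_of_ne hw.2 (Ne.symm hne)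
      have hm : InCone (Bsharp k) := cone_dual fun v hv => by
        rw [hrel]; exact cone_pair hw ⟨(hcaus v hv).2.2.le, (hcaus v hv).2.1⟩
      have hmk : 0 < eta (Bsharp k) k := by
        rw [hrel]; exact cone_pair_strict hw.1 hpos hx
      have hm0 : 0 < Bsharp k 0 := by
        refine lt_of_le_of_ne hm.1 fun h0 => ?_
        have h1 := hm.2
        have h2 := spDot_cs (Bsharp k) k
        have h3 := spDot_nonneg (Bsharp k)
        rw [eta_eq, ← h0] at h1 hmk
        have h4 : spDot (Bsharp k) (Bsharp k) = 0 := by linarith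
        rw [h4] at h2
        nlinarith
      have hmc : FutureCausal (Bsharp k) :=
        ⟨fun h => by rw [h] at hm0; simp at hm0, hm.2, hm0⟩
      have := cone_pair_strict hw.1 hpos (hcaus _ hmc)
      rw [← hrel, hB] at this
      exact lt_irrefl _ this
    refine ⟨?_, hw0⟩
    by_contra hne
    exact hex ⟨L k, hx.2.2, lt_of_le_of_ne hx.2.1 (Ne.symm hne), hw0⟩
end

section
/- Let n ≥ 3 and let B be a symmetric bilinear form on ℝⁿ such that B(k,k) = 0 for every null vector k. Then there exists a real constant c such that B(u,v) = c · η(u,v) for all u,v ∈ ℝⁿ. (A rank-2 symmetric tensor whose set of principal null directions spans the whole null cone is proportional to the metric.) -/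
open Finset

lemma eta_three {n : ℕ} [NeZero n] (i j : Fin n) (hi : i ≠ 0) (hj : j ≠ 0) (hij : i ≠ j)
    (a b c : ℝ) :
    eta (a • Pi.single 0 1 + b • Pi.single i 1 + c • Pi.single j 1 : Fin n → ℝ)
      (a • Pi.single 0 1 + b • Pi.single i 1 + c • Pi.single j 1 : Fin n → ℝ)
      = a * a - b * b - c * c := by
  have h : ∀ x ∈ Finset.univ.filter (fun x : Fin n => x ≠ 0),
      (a • Pi.single 0 1 + b • Pi.single i 1 + c • Pi.single j 1 : Fin n → ℝ) x *
      (a • Pi.single 0 1 + b • Pi.single i 1 + c • Pi.single j 1 : Fin n → ℝ) x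
      = (if x = i then b * b else 0) + (if x = j then c * c else 0) := by
    intro x hx
    have hx0 : x ≠ 0 := by simpa using hx
    by_cases h1 : x = i
    · subst h1
      simp [Pi.single_apply, hx0, hij]
    · by_cases h2 : x = j
      · subst h2
        simp [Pi.single_apply, hx0, h1]
      · simp [Pi.single_apply, hx0, h1, h2]
  unfold eta
  rw [Finset.sum_congr rfl h, Finset.sum_add_distrib, Finset.sum_ite_eq', Finset.sum_ite_eq']
  simp [Pi.single_apply, hi, hj, hi.symm, hj.symm]
  ring

/-- A symmetric bilinear form vanishing on the whole null cone is proportional to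
the Minkowski metric. -/
theorem stmt_19 {n : ℕ} [NeZero n] (hn : 3 ≤ n)
    (B : (Fin n → ℝ) →ₗ[ℝ] (Fin n → ℝ) →ₗ[ℝ] ℝ)
    (hsym : ∀ u v, B u v = B v u)
    (hnull : ∀ k, IsNull k → B k k = 0) :
    ∃ c : ℝ, ∀ u v, B u v = c * eta u v := by
  have key : ∀ i j : Fin n, i ≠ 0 → j ≠ 0 → i ≠ j → ∀ a b c : ℝ, a ≠ 0 →
      a * a - b * b - c * c = 0 →
      a * a * B (Pi.single 0 1) (Pi.single 0 1) + b * b * B (Pi.single i 1) (Pi.single i 1)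
      + c * c * B (Pi.single j 1) (Pi.single j 1)
      + 2 * (a * b * B (Pi.single 0 1) (Pi.single i 1))
      + 2 * (a * c * B (Pi.single 0 1) (Pi.single j 1))
      + 2 * (b * c * B (Pi.single i 1) (Pi.single j 1)) = 0 := by
    intro i j hi hj hij a b c ha habc
    have h := hnull (a • Pi.single 0 1 + b • Pi.single i 1 + c • Pi.single j 1) ⟨?_, ?_⟩
    · simp only [map_add, map_smul, LinearMap.add_apply, LinearMap.smul_apply, smul_eq_mul] at h
      rw [hsym (Pi.single i 1) (Pi.single 0 1), hsym (Pi.single j 1) (Pi.single 0 1),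
        hsym (Pi.single j 1) (Pi.single i 1)] at h
      linarith
    · intro h0
      have := congrFun h0 0
      simp [Pi.single_apply, hi.symm, hj.symm] at this
      exact ha this
    · rw [eta_three i j hi hj hij, habc]
  have other : ∀ i : Fin n, i ≠ 0 → ∃ j : Fin n, j ≠ 0 ∧ i ≠ j := by
    intro i _
    have hc : ({0, i} : Finset (Fin n)).card < (Finset.univ : Finset (Fin n)).card := by
      have := Finset.card_le_two (a := (0 : Fin n)) (b := i)
      simp only [Finset.card_univ, Fintype.card_fin]
      omega
    obtain ⟨j, -, hj⟩ := Finset.exists_mem_notMem_of_card_lt_card hc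
    simp only [Finset.mem_insert, Finset.mem_singleton, not_or] at hj
    exact ⟨j, hj.1, fun h => hj.2 h.symm⟩
  set c := B (Pi.single 0 1) (Pi.single 0 1) with hc
  have h0 : ∀ i : Fin n, i ≠ 0 → B (Pi.single 0 1) (Pi.single i 1) = 0 ∧
      B (Pi.single i 1) (Pi.single i 1) = -c := by
    intro i hi
    obtain ⟨j, hj, hij⟩ := other i hi
    have h1 := key i j hi hj hij 1 1 0 (by norm_num) (by norm_num)
    have h2 := key i j hi hj hij 1 (-1) 0 (by norm_num) (by norm_num)
    constructor <;> linarith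
  have hoff : ∀ i j : Fin n, i ≠ 0 → j ≠ 0 → i ≠ j →
      B (Pi.single i 1) (Pi.single j 1) = 0 := by
    intro i j hi hj hij
    have h := key i j hi hj hij 5 3 4 (by norm_num) (by norm_num)
    rw [(h0 i hi).1, (h0 i hi).2, (h0 j hj).1, (h0 j hj).2] at h
    linarith
  have hb : ∀ i j : Fin n, B (Pi.single i 1) (Pi.single j 1) =
      if i = j then (if i = 0 then c else -c) else 0 := by
    intro i j
    by_cases hij : i = j
    · subst hij
      by_cases hi : i = 0
      · subst hi
        simp [hc]
      · simp [hi, (h0 i hi).2]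
    · rw [if_neg hij]
      by_cases hi : i = 0
      · subst hi
        exact (h0 j (Ne.symm hij)).1
      · by_cases hj : j = 0
        · subst hj
          rw [hsym]
          exact (h0 i hi).1
        · exact hoff i j hi hj hij
  refine ⟨c, fun u v => ?_⟩
  have hB : B u v = ∑ i, u i * v i * (if i = 0 then c else -c) := by
    conv_lhs => rw [pi_eq_sum_univ' u, pi_eq_sum_univ' v]
    simp only [map_sum, map_smul, LinearMap.sum_apply, LinearMap.smul_apply, smul_eq_mul]
    have e : ∀ i : Fin n, (fun j => if j = i then (1 : ℝ) else 0) = Pi.single i 1 := by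
      intro i
      ext j
      simp [Pi.single_apply]
    simp only [e, hb]
    simp [mul_assoc]
    refine Finset.sum_congr rfl fun x _ => ?_
    split_ifs <;> ring
  rw [hB, eta, ← Finset.sum_filter_add_sum_filter_not Finset.univ (fun i : Fin n => i = 0),
    Finset.filter_eq' Finset.univ (0 : Fin n), if_pos (Finset.mem_univ _), Finset.sum_singleton,
    mul_sub, Finset.mul_sum, if_pos rfl, sub_eq_add_neg, ← Finset.sum_neg_distrib]
  congr 1
  · ring
  · refine Finset.sum_congr rfl fun i hi => ?_
    rw [if_neg (by simpa using hi)]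
    ring
end
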